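/- arXiv:2505.09734 — 7 statements merged into one kernel-verified Lean document; each statement's English description precedes it below -/
import Mathlib

section
/- Let n, n_v, q be positive integers, let A ∈ ℝ^{n×n}, let 0 < λ ≤ 1, and let P_1, …, P_{n_v} be symmetric positive definite n×n matrices. Let F ∈ ℝ^{q×n} with rows F_l and let g ∈ ℝ^q have entries g_l > 0. Suppose that for every i ∈ {1,…,n_v}, with j = mod(i + n_v − 2, n_v) + 1, the block matrix [[P_i, A P_j], [P_j Aᵀ, λ P_j]] is positive semidefinite, and that for every i ∈ {1,…,n_v} and every l ∈ {1,…,q} the block matrix [[P_i, P_i F_lᵀ], [F_l P_i, g_l²]] is positive semidefinite. Then the set S_c = conv(⋃_{i=1}^{n_v} E(P_i,1)) satisfies: (a) S_c ⊆ {x ∈ ℝ^n : F x ≤ g componentwise}; and (b) for every x ∈ S_c, A x ∈ conv(⋃_{i=1}^{n_v} {z ∈ ℝ^n : zᵀ P_i⁻¹ z ≤ λ}); in particular A x ∈ √λ · S_c, so S_c is a contractive invariant set for the dynamics x(t+1) = A x(t). -/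
open Matrix Set Pointwise

theorem aux_block {m k : Type*} [Fintype m] [Fintype k]
    {P : Matrix m m ℝ} {B : Matrix m k ℝ} {C : Matrix k m ℝ} {D : Matrix k k ℝ}
    (h : (Matrix.fromBlocks P B C D).PosSemidef) (u : m → ℝ) (w : k → ℝ) :
    0 ≤ u ⬝ᵥ (P *ᵥ u) + u ⬝ᵥ (B *ᵥ w) + (w ⬝ᵥ (C *ᵥ u) + w ⬝ᵥ (D *ᵥ w)) := by
  have h1 := h.dotProduct_mulVec_nonneg (Sum.elim u w)
  rw [star_trivial, Matrix.fromBlocks_mulVec, sumElim_dotProduct_sumElim,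
    dotProduct_add, dotProduct_add] at h1
  simpa using h1

theorem aux_inv {n : ℕ} {P : Matrix (Fin n) (Fin n) ℝ} (hP : P.PosDef) (x : Fin n → ℝ) :
    P *ᵥ (P⁻¹ *ᵥ x) = x := by
  rw [mulVec_mulVec, Matrix.mul_nonsing_inv _ ((Matrix.isUnit_iff_isUnit_det _).1 hP.isUnit),
    one_mulVec]

theorem aux_symm {n : ℕ} {P : Matrix (Fin n) (Fin n) ℝ} (hP : P.PosDef) (x y : Fin n → ℝ) :
    x ⬝ᵥ (P *ᵥ y) = (P *ᵥ x) ⬝ᵥ y := by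
  have h : Pᵀ = P := by simpa using hP.isHermitian.eq
  rw [dotProduct_mulVec, ← mulVec_transpose, h]

theorem aux_map {n : ℕ} {A P Q : Matrix (Fin n) (Fin n) ℝ} {lam : ℝ} (hlam : 0 < lam)
    (hP : P.PosDef) (hQ : Q.PosDef)
    (h : (Matrix.fromBlocks P (A * Q) (Q * Aᵀ) (lam • Q)).PosSemidef)
    {x : Fin n → ℝ} (hx : x ⬝ᵥ (Q⁻¹ *ᵥ x) ≤ 1) :
    (A *ᵥ x) ⬝ᵥ (P⁻¹ *ᵥ (A *ᵥ x)) ≤ lam := by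
  have h1 := aux_block h (-(P⁻¹ *ᵥ (A *ᵥ x))) (Q⁻¹ *ᵥ x)
  simp only [smul_mulVec, ← mulVec_mulVec, mulVec_neg, neg_dotProduct, dotProduct_neg,
    dotProduct_smul, aux_inv hP, aux_inv hQ, neg_neg, smul_eq_mul] at h1
  rw [aux_symm hQ, aux_inv hQ, dotProduct_mulVec x, vecMul_transpose,
    dotProduct_comm (P⁻¹ *ᵥ (A *ᵥ x)), dotProduct_comm (Q⁻¹ *ᵥ x)] at h1
  nlinarith

theorem aux_poly {n : ℕ} {P : Matrix (Fin n) (Fin n) ℝ} (hP : P.PosDef)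
    {f : Fin n → ℝ} {g : ℝ} (hg : 0 < g)
    (h : (Matrix.fromBlocks P (Matrix.of fun r (_ : Fin 1) => (P *ᵥ f) r)
        (Matrix.of fun (_ : Fin 1) c => (f ᵥ* P) c)
        ((g ^ 2) • (1 : Matrix (Fin 1) (Fin 1) ℝ))).PosSemidef)
    {x : Fin n → ℝ} (hx : x ⬝ᵥ (P⁻¹ *ᵥ x) ≤ 1) : f ⬝ᵥ x ≤ g := by
  have h1 := aux_block h (g • (P⁻¹ *ᵥ x)) (fun _ => -1)
  have e1 : (Matrix.of fun r (_ : Fin 1) => (P *ᵥ f) r) *ᵥ (fun _ => (-1 : ℝ)) = -(P *ᵥ f) := by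
    ext r; simp [mulVec, dotProduct]
  have e2 : (Matrix.of fun (_ : Fin 1) c => (f ᵥ* P) c) *ᵥ (P⁻¹ *ᵥ x) = fun _ => f ⬝ᵥ x := by
    ext r
    change (f ᵥ* P) ⬝ᵥ (P⁻¹ *ᵥ x) = _
    rw [← dotProduct_mulVec, aux_inv hP]
  rw [e1, mulVec_smul, mulVec_smul, e2, aux_inv hP, dotProduct_neg, smul_dotProduct,
    smul_dotProduct, aux_symm hP, aux_inv hP, dotProduct_smul, dotProduct_comm _ x,
    dotProduct_comm x f] at h1
  have e3 : ∀ a b : ℝ, (fun _ : Fin 1 => a) ⬝ᵥ (fun _ : Fin 1 => b) = a * b := by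
    intro a b; simp [dotProduct]
  simp only [smul_mulVec, one_mulVec, dotProduct_smul, smul_eq_mul, e3] at h1
  have h2 : g * (g * (x ⬝ᵥ (P⁻¹ *ᵥ x))) ≤ g * (g * 1) := by gcongr
  have h3 : g * (f ⬝ᵥ x) ≤ g * g := by nlinarith
  exact le_of_mul_le_mul_left h3 hg

/-- Theorem 1 of the paper (open-loop safety via a convex hull of ellipsoids):
feasibility of the LMIs implies that the convex hull of the ellipsoids is contained
in the admissible polyhedron and is λ-contractive for `x(t+1) = A x(t)`. -/
theorem openLoop_convexHull_contractive
    (n nv q : ℕ) (hn : 0 < n) (hnv : 0 < nv) (hq : 0 < q)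
    (A : Matrix (Fin n) (Fin n) ℝ) (lam : ℝ) (hlam : 0 < lam) (hlam1 : lam ≤ 1)
    (P : ℕ → Matrix (Fin n) (Fin n) ℝ)
    (hP : ∀ i ∈ Finset.Icc 1 nv, (P i).PosDef)
    (F : ℕ → Fin n → ℝ) (g : ℕ → ℝ)
    (hg : ∀ l ∈ Finset.Icc 1 q, 0 < g l)
    (hLMI : ∀ i ∈ Finset.Icc 1 nv,
      (Matrix.fromBlocks (P i) (A * P ((i + nv - 2) % nv + 1))
        (P ((i + nv - 2) % nv + 1) * Aᵀ)
        (lam • P ((i + nv - 2) % nv + 1))).PosSemidef)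
    (hPoly : ∀ i ∈ Finset.Icc 1 nv, ∀ l ∈ Finset.Icc 1 q,
      (Matrix.fromBlocks (P i) (Matrix.of fun r (_ : Fin 1) => ((P i) *ᵥ (F l)) r)
        (Matrix.of fun (_ : Fin 1) c => ((F l) ᵥ* (P i)) c)
        ((g l ^ 2) • (1 : Matrix (Fin 1) (Fin 1) ℝ))).PosSemidef) :
    (convexHull ℝ (⋃ i ∈ Finset.Icc 1 nv, {x : Fin n → ℝ | x ⬝ᵥ ((P i)⁻¹ *ᵥ x) ≤ 1})
        ⊆ {x : Fin n → ℝ | ∀ l ∈ Finset.Icc 1 q, F l ⬝ᵥ x ≤ g l}) ∧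
    (∀ x ∈ convexHull ℝ (⋃ i ∈ Finset.Icc 1 nv, {x : Fin n → ℝ | x ⬝ᵥ ((P i)⁻¹ *ᵥ x) ≤ 1}),
      A *ᵥ x ∈
        convexHull ℝ (⋃ i ∈ Finset.Icc 1 nv, {z : Fin n → ℝ | z ⬝ᵥ ((P i)⁻¹ *ᵥ z) ≤ lam}) ∧
      A *ᵥ x ∈ Real.sqrt lam •
        convexHull ℝ (⋃ i ∈ Finset.Icc 1 nv, {x : Fin n → ℝ | x ⬝ᵥ ((P i)⁻¹ *ᵥ x) ≤ 1})) := by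
  have key : ∀ j ∈ Finset.Icc 1 nv, ∃ i ∈ Finset.Icc 1 nv, (i + nv - 2) % nv + 1 = j := by
    intro j hj
    rw [Finset.mem_Icc] at hj
    rcases hj.2.lt_or_eq with h | h
    · refine ⟨j + 1, by rw [Finset.mem_Icc]; omega, ?_⟩
      have : j + 1 + nv - 2 = (j - 1) + nv := by omega
      rw [this, Nat.add_mod_right, Nat.mod_eq_of_lt (by omega)]
      omega
    · refine ⟨1, by rw [Finset.mem_Icc]; omega, ?_⟩
      rcases Nat.lt_or_ge 1 nv with h2 | h2
      · have : 1 + nv - 2 = nv - 1 := by omega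
        rw [this, Nat.mod_eq_of_lt (by omega)]
        omega
      · have : nv = 1 := by omega
        subst this
        simp [h]
  have main : ∀ x ∈ convexHull ℝ
      (⋃ i ∈ Finset.Icc 1 nv, {x : Fin n → ℝ | x ⬝ᵥ ((P i)⁻¹ *ᵥ x) ≤ 1}),
      A *ᵥ x ∈ convexHull ℝ
        (⋃ i ∈ Finset.Icc 1 nv, {z : Fin n → ℝ | z ⬝ᵥ ((P i)⁻¹ *ᵥ z) ≤ lam}) := by
    intro x hx
    have hm := mem_image_of_mem A.mulVecLin hx
    rw [LinearMap.image_convexHull] at hm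
    refine convexHull_mono ?_ hm
    rintro _ ⟨y, hy, rfl⟩
    simp only [mem_iUnion, mem_setOf_eq, exists_prop] at hy ⊢
    obtain ⟨j, hj, hy⟩ := hy
    obtain ⟨i, hi, rfl⟩ := key j hj
    exact ⟨i, hi, aux_map hlam (hP i hi) (hP _ hj) (hLMI i hi) hy⟩
  refine ⟨?_, fun x hx => ⟨main x hx, ?_⟩⟩
  · refine convexHull_min ?_ ?_
    · intro x hx
      simp only [mem_iUnion, mem_setOf_eq, exists_prop] at hx ⊢
      obtain ⟨i, hi, hx⟩ := hx
      exact fun l hl => aux_poly (hP i hi) (hg l hl) (hPoly i hi l hl) hx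
    · intro x hx y hy a b ha hb hab l hl
      have h1 := mul_le_mul_of_nonneg_left (hx l hl) ha
      have h2 := mul_le_mul_of_nonneg_left (hy l hl) hb
      rw [dotProduct_add, dotProduct_smul, dotProduct_smul, smul_eq_mul, smul_eq_mul]
      calc _ ≤ a * g l + b * g l := add_le_add h1 h2
        _ = g l := by rw [← add_mul, hab, one_mul]
  · rw [← convexHull_smul]
    refine convexHull_mono ?_ (main x hx)
    intro z hz
    simp only [mem_iUnion, mem_setOf_eq, exists_prop] at hz
    obtain ⟨i, hi, hz⟩ := hz
    have hs : 0 < Real.sqrt lam := Real.sqrt_pos.2 hlam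
    rw [mem_smul_set_iff_inv_smul_mem₀ hs.ne']
    simp only [mem_iUnion, mem_setOf_eq, exists_prop]
    refine ⟨i, hi, ?_⟩
    rw [mulVec_smul, dotProduct_smul, smul_dotProduct, smul_eq_mul, smul_eq_mul, ← mul_assoc,
      ← mul_inv, Real.mul_self_sqrt hlam.le, inv_mul_le_iff₀ hlam, mul_one]
    exact hz
end

section
/- Let P_1, …, P_m be symmetric positive definite n×n real matrices, let α_1, …, α_m ≥ 0 with ∑_{i=1}^m α_i = 1, let M = ∑_{i=1}^m α_i P_i (which is symmetric positive definite), and let r ≥ 0. Then the ellipsoid {x ∈ ℝ^n : xᵀ M⁻¹ x ≤ r} is contained in the convex hull conv(⋃_{i=1}^m {x ∈ ℝ^n : xᵀ P_i⁻¹ x ≤ r}). -/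
open Matrix Set

/-- The sublevel-`r` ellipsoid of a convex combination `M = ∑ αᵢ Pᵢ` of positive
definite matrices is contained in the convex hull of the individual ellipsoids. -/
theorem ellipsoid_of_convexCombination_subset_convexHull
    (n m : ℕ) (P : Fin m → Matrix (Fin n) (Fin n) ℝ) (hP : ∀ i, (P i).PosDef)
    (α : Fin m → ℝ) (hα : ∀ i, 0 ≤ α i) (hsum : ∑ i, α i = 1) (r : ℝ) (hr : 0 ≤ r) :
    (∑ i, α i • P i).PosDef ∧
    {x : Fin n → ℝ | x ⬝ᵥ ((∑ i, α i • P i)⁻¹ *ᵥ x) ≤ r} ⊆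
      convexHull ℝ (⋃ i, {x : Fin n → ℝ | x ⬝ᵥ ((P i)⁻¹ *ᵥ x) ≤ r}) := by
  obtain ⟨i0, hi0⟩ : ∃ i, 0 < α i := by
    by_contra! h
    have : ∑ i, α i ≤ 0 := Finset.sum_nonpos fun i _ => h i
    linarith
  have hM : (∑ i, α i • P i).PosDef := by
    rw [← Finset.add_sum_erase _ _ (Finset.mem_univ i0)]
    refine ((hP i0).smul hi0).add_posSemidef ?_
    exact Matrix.posSemidef_sum _ fun i _ => (hP i).posSemidef.smul (hα i)
  refine ⟨hM, ?_⟩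
  intro x hx
  change _ ≤ r at hx
  set C := convexHull ℝ (⋃ i, {x : Fin n → ℝ | x ⬝ᵥ ((P i)⁻¹ *ᵥ x) ≤ r}) with hC
  have hconv : Convex ℝ C := convex_convexHull ℝ _
  have hsub : ∀ i z, z ⬝ᵥ ((P i)⁻¹ *ᵥ z) ≤ r → z ∈ C := fun i z hz =>
    subset_convexHull ℝ _ (mem_iUnion.2 ⟨i, hz⟩)
  have h0 : (0 : Fin n → ℝ) ∈ C := hsub i0 0 (by simpa using hr)
  rcases hr.eq_or_lt with rfl | hr
  · have : x = 0 := by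
      by_contra hne
      have := hM.inv.dotProduct_mulVec_pos hne
      simp only [star_trivial] at this
      linarith
    rwa [this]
  set M := ∑ i, α i • P i with hMdef
  set y := M⁻¹ *ᵥ x with hy
  have hxy : x = ∑ i, α i • (P i *ᵥ y) := by
    have : M *ᵥ y = x := by
      rw [hy, mulVec_mulVec, mul_nonsing_inv _ ((isUnit_iff_isUnit_det _).1 hM.isUnit), one_mulVec]
    rw [← this, hMdef, sum_mulVec]
    simp [smul_mulVec]
  clear_value y
  set q : Fin m → ℝ := fun i => y ⬝ᵥ (P i *ᵥ y) with hq
  have hq0 : ∀ i, 0 ≤ q i := fun i => by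
    simpa using (hP i).posSemidef.dotProduct_mulVec_nonneg y
  have hqs : ∑ i, α i * q i ≤ r := by
    refine le_of_eq_of_le ?_ hx
    rw [dotProduct_comm, hxy, dotProduct_sum]
    simp [hq]
  have hz : ∀ i, (2 * r / (r + q i)) • (P i *ᵥ y) ∈ C := by
    intro i
    apply hsub i
    have hpos : 0 < r + q i := by linarith [hq0 i]
    rw [mulVec_smul, mulVec_mulVec,
      nonsing_inv_mul _ ((isUnit_iff_isUnit_det _).1 (hP i).isUnit), one_mulVec,
      smul_dotProduct, dotProduct_smul, dotProduct_comm]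
    change (2 * r / (r + q i)) * ((2 * r / (r + q i)) * q i) ≤ r
    have : (2 * r / (r + q i)) * ((2 * r / (r + q i)) * q i)
        = r * (4 * r * q i) / (r + q i) ^ 2 := by field_simp; ring
    rw [this, div_le_iff₀ (by positivity)]
    exact mul_le_mul_of_nonneg_left (by nlinarith [sq_nonneg (r - q i)]) hr.le
  set β : Fin m → ℝ := fun i => α i * (r + q i) / (2 * r) with hβ
  have hβ0 : ∀ i, 0 ≤ β i := fun i =>
    div_nonneg (mul_nonneg (hα i) (by linarith [hq0 i])) (by linarith)
  have hT : ∑ i, β i = (r + ∑ i, α i * q i) / (2 * r) := by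
    simp only [hβ, mul_add]
    rw [← Finset.sum_div, Finset.sum_add_distrib, ← Finset.sum_mul, hsum, one_mul]
  have hs0 : 0 ≤ ∑ i, α i * q i := Finset.sum_nonneg fun i _ => mul_nonneg (hα i) (hq0 i)
  have hTpos : 0 < ∑ i, β i := by rw [hT]; positivity
  have hT1 : ∑ i, β i ≤ 1 := by rw [hT, div_le_one (by positivity)]; linarith
  have hcm := hconv.centerMass_mem (t := Finset.univ) (fun i _ => hβ0 i) hTpos (fun i _ => hz i)
  have := hconv.smul_mem_of_zero_mem h0 hcm ⟨hTpos.le, hT1⟩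
  rw [Finset.centerMass, smul_smul, mul_inv_cancel₀ hTpos.ne', one_smul] at this
  convert this using 1
  rw [hxy]
  refine Finset.sum_congr rfl fun i _ => ?_
  have hpos : 0 < r + q i := by linarith [hq0 i]
  rw [smul_smul]
  congr 1
  simp only [hβ]
  field_simp
end

section
/- Let n, n_v be positive integers, A ∈ ℝ^{n×n}, 0 < λ ≤ 1, and let P_1, …, P_{n_v} be symmetric positive definite n×n matrices such that for every i ∈ {1,…,n_v}, with j = mod(i + n_v − 2, n_v) + 1, the block matrix [[P_i, A P_j], [P_j Aᵀ, λ P_j]] is positive semidefinite. Then for every i ∈ {1,…,n_v} and j = mod(i + n_v − 2, n_v) + 1, every point υ with υᵀ P_j⁻¹ υ ≤ 1 satisfies (Aυ)ᵀ P_i⁻¹ (Aυ) ≤ λ. In other words, the map x ↦ Ax sends the ellipsoid E(P_j,1) into the scaled ellipsoid {z : zᵀ P_i⁻¹ z ≤ λ}, so trajectories traverse the ellipsoids cyclically in the order prescribed by the rotational indexing. -/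
open Matrix Set

/-- Proposition 1 of the paper: under the LMI conditions of Theorem 1, the map
`x ↦ A x` sends the ellipsoid `E(P_j,1)` into the scaled ellipsoid
`{z : zᵀ P_i⁻¹ z ≤ λ}`, where `j = mod(i + n_v − 2, n_v) + 1`, so trajectories
traverse the ellipsoids cyclically. -/
theorem cyclic_ellipsoid_traversal
    (n nv : ℕ) (hn : 0 < n) (hnv : 0 < nv)
    (A : Matrix (Fin n) (Fin n) ℝ) (lam : ℝ) (hlam : 0 < lam) (hlam1 : lam ≤ 1)
    (P : ℕ → Matrix (Fin n) (Fin n) ℝ)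
    (hP : ∀ i ∈ Finset.Icc 1 nv, (P i).PosDef)
    (hLMI : ∀ i ∈ Finset.Icc 1 nv,
      (Matrix.fromBlocks (P i) (A * P ((i + nv - 2) % nv + 1))
        (P ((i + nv - 2) % nv + 1) * Aᵀ)
        (lam • P ((i + nv - 2) % nv + 1))).PosSemidef) :
    ∀ i ∈ Finset.Icc 1 nv, ∀ υ : Fin n → ℝ,
      υ ⬝ᵥ ((P ((i + nv - 2) % nv + 1))⁻¹ *ᵥ υ) ≤ 1 →
      (A *ᵥ υ) ⬝ᵥ ((P i)⁻¹ *ᵥ (A *ᵥ υ)) ≤ lam := by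
  intro i hi υ hυ
  have hj : (i + nv - 2) % nv + 1 ∈ Finset.Icc 1 nv := by
    have := Nat.mod_lt (i + nv - 2) hnv
    rw [Finset.mem_Icc]
    omega
  have hM := hLMI i hi
  have hPi := hP i hi
  have hPj := hP _ hj
  generalize P ((i + nv - 2) % nv + 1) = Q at *
  generalize P i = R at *
  have hR : IsUnit R.det := (Matrix.isUnit_iff_isUnit_det R).1 hPi.isUnit
  have hQ : IsUnit Q.det := (Matrix.isUnit_iff_isUnit_det Q).1 hPj.isUnit
  have hQt : Qᵀ = Q := by
    have := hPj.isHermitian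
    rwa [Matrix.IsHermitian, Matrix.conjTranspose_eq_transpose_of_trivial] at this
  obtain ⟨z, hz⟩ : ∃ z, z = R⁻¹ *ᵥ (A *ᵥ υ) := ⟨_, rfl⟩
  obtain ⟨w, hw⟩ : ∃ w, w = Q⁻¹ *ᵥ υ := ⟨_, rfl⟩
  have hRz : R *ᵥ z = A *ᵥ υ := by
    rw [hz, Matrix.mulVec_mulVec, Matrix.mul_nonsing_inv _ hR, Matrix.one_mulVec]
  have hQw : Q *ᵥ w = υ := by
    rw [hw, Matrix.mulVec_mulVec, Matrix.mul_nonsing_inv _ hQ, Matrix.one_mulVec]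
  rw [← hz]
  rw [← hw] at hυ
  have key := hM.dotProduct_mulVec_nonneg (Sum.elim (-z) w)
  have hcross : w ⬝ᵥ (Q *ᵥ (Aᵀ *ᵥ z)) = (A *ᵥ υ) ⬝ᵥ z := by
    rw [Matrix.dotProduct_mulVec, ← Matrix.mulVec_transpose, hQt, hQw,
      Matrix.dotProduct_mulVec, Matrix.vecMul_transpose]
  rw [star_trivial, Matrix.fromBlocks_mulVec, Sum.elim_comp_inl, Sum.elim_comp_inr,
    sumElim_dotProduct_sumElim, ← Matrix.mulVec_mulVec, ← Matrix.mulVec_mulVec, hQw,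
    Matrix.mulVec_neg, hRz, neg_add_cancel, dotProduct_zero, zero_add, dotProduct_add,
    Matrix.mulVec_neg, Matrix.mulVec_neg, dotProduct_neg, hcross, Matrix.smul_mulVec, hQw,
    dotProduct_smul, smul_eq_mul, dotProduct_comm w υ] at key
  nlinarith
end

section
/- Let n, m, n_v, q be positive integers, A ∈ ℝ^{n×n}, B ∈ ℝ^{n×m}, 0 < λ ≤ 1, and let P_1, …, P_{n_v} be symmetric positive definite n×n matrices and S_1, …, S_{n_v} ∈ ℝ^{m×n}. Let F ∈ ℝ^{q×n} with rows F_l and g ∈ ℝ^q with entries g_l > 0. Suppose that for every i ∈ {1,…,n_v}, with j = mod(i + n_v − 2, n_v) + 1, the block matrix [[P_i, A P_j + B S_j], [(A P_j + B S_j)ᵀ, λ P_j]] is positive semidefinite, and that for every i and every l the block matrix [[P_i, P_i F_lᵀ], [F_l P_i, g_l²]] is positive semidefinite. Define K_i = S_i P_i⁻¹. Then: (a) (A + B K_j)ᵀ P_i⁻¹ (A + B K_j) ⪯ λ P_j⁻¹ for every i and the corresponding j; (b) for every x ∈ S_c = conv(⋃_{i=1}^{n_v} E(P_i,1)), written as x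 = ∑_{i=1}^{n_v} α_i υ_i with υ_i ∈ E(P_i,1), α_i ≥ 0, ∑_i α_i = 1, the control input u = ∑_{i=1}^{n_v} α_i K_i υ_i satisfies A x + B u ∈ conv(⋃_{i=1}^{n_v} {z : zᵀ P_i⁻¹ z ≤ λ}) ⊆ S_c; and (c) S_c ⊆ {x : F x ≤ g componentwise}. -/
open Matrix Set

theorem cl_schur {n m : ℕ} (A : Matrix (Fin n) (Fin n) ℝ) (B : Matrix (Fin n) (Fin m) ℝ)
    (lam : ℝ) (P Q : Matrix (Fin n) (Fin n) ℝ) (S : Matrix (Fin m) (Fin n) ℝ)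
    (hP : P.PosDef) (hQ : Q.PosDef)
    (h : (Matrix.fromBlocks P (A * Q + B * S) ((A * Q + B * S)ᵀ) (lam • Q)).PosSemidef) :
    (lam • Q⁻¹ - (A + B * (S * Q⁻¹))ᵀ * P⁻¹ * (A + B * (S * Q⁻¹))).PosSemidef := by
  have hu : IsUnit Q.det := (Matrix.isUnit_iff_isUnit_det _).1 hQ.isUnit
  let _ := hP.isUnit.invertible
  rw [← Matrix.conjTranspose_eq_transpose_of_trivial, Matrix.PosDef.fromBlocks₁₁ _ _ hP] at h
  have h2 := h.conjTranspose_mul_mul_same Q⁻¹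
  have hM : (A * Q + B * S) * Q⁻¹ = A + B * (S * Q⁻¹) := by
    rw [Matrix.add_mul, Matrix.mul_assoc, Matrix.mul_nonsing_inv _ hu, Matrix.mul_one,
      Matrix.mul_assoc]
  have hQi : (Q⁻¹)ᴴ = Q⁻¹ := hQ.inv.isHermitian
  have e : lam • Q⁻¹ - (A + B * (S * Q⁻¹))ᵀ * P⁻¹ * (A + B * (S * Q⁻¹)) =
      (Q⁻¹)ᴴ * (lam • Q - (A * Q + B * S)ᴴ * P⁻¹ * (A * Q + B * S)) * Q⁻¹ := by
    rw [Matrix.mul_sub, Matrix.sub_mul, ← hM, ← Matrix.conjTranspose_eq_transpose_of_trivial,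
      Matrix.conjTranspose_mul]
    congr 1
    · rw [hQi, Matrix.mul_smul, Matrix.nonsing_inv_mul _ hu, Matrix.smul_mul, Matrix.one_mul]
    · simp only [Matrix.mul_assoc]
  rw [e]
  exact h2

theorem cl_quad {n : ℕ} (lam : ℝ) (P Q K : Matrix (Fin n) (Fin n) ℝ) (hlam : 0 < lam)
    (h : (lam • Q⁻¹ - Kᵀ * P⁻¹ * K).PosSemidef) (v : Fin n → ℝ)
    (hv : v ⬝ᵥ (Q⁻¹ *ᵥ v) ≤ 1) : (K *ᵥ v) ⬝ᵥ (P⁻¹ *ᵥ (K *ᵥ v)) ≤ lam := by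
  have h1 := h.dotProduct_mulVec_nonneg v
  rw [star_trivial, Matrix.sub_mulVec, dotProduct_sub, Matrix.smul_mulVec, dotProduct_smul,
    smul_eq_mul, ← Matrix.mulVec_mulVec, ← Matrix.mulVec_mulVec, Matrix.dotProduct_mulVec v Kᵀ,
    Matrix.vecMul_transpose] at h1
  nlinarith

theorem cl_poly {n : ℕ} (P : Matrix (Fin n) (Fin n) ℝ) (hP : P.PosDef) (F : Fin n → ℝ) (g : ℝ)
    (hg : 0 < g)
    (h : (Matrix.fromBlocks P (Matrix.of fun r (_ : Fin 1) => (P *ᵥ F) r)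
        (Matrix.of fun (_ : Fin 1) c => (F ᵥ* P) c)
        ((g ^ 2) • (1 : Matrix (Fin 1) (Fin 1) ℝ))).PosSemidef)
    (x : Fin n → ℝ) (hx : x ⬝ᵥ (P⁻¹ *ᵥ x) ≤ 1) : F ⬝ᵥ x ≤ g := by
  have hu : IsUnit P.det := (Matrix.isUnit_iff_isUnit_det _).1 hP.isUnit
  have hPx : P *ᵥ (P⁻¹ *ᵥ x) = x := by
    rw [Matrix.mulVec_mulVec, Matrix.mul_nonsing_inv _ hu, Matrix.one_mulVec]
  have hPt : Pᵀ = P := by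
    rw [← Matrix.conjTranspose_eq_transpose_of_trivial]; exact hP.isHermitian
  have h1 := h.dotProduct_mulVec_nonneg (Sum.elim (g • (P⁻¹ *ᵥ x)) (fun _ => (-1 : ℝ)))
  have e1 : (Matrix.of fun r (_ : Fin 1) => (P *ᵥ F) r) *ᵥ (fun _ => (-1 : ℝ)) = - (P *ᵥ F) := by
    ext r; simp [Matrix.mulVec, dotProduct]
  have e2 : (Matrix.of fun (_ : Fin 1) c => (F ᵥ* P) c) *ᵥ (g • (P⁻¹ *ᵥ x))
      = fun _ => g * (F ⬝ᵥ x) := by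
    ext r
    rw [Matrix.mulVec_smul]
    change g * ((F ᵥ* P) ⬝ᵥ (P⁻¹ *ᵥ x)) = _
    rw [← Matrix.dotProduct_mulVec, hPx]
  have e3 : (P⁻¹ *ᵥ x) ⬝ᵥ (P *ᵥ F) = F ⬝ᵥ x := by
    rw [Matrix.dotProduct_mulVec, ← Matrix.mulVec_transpose, hPt, hPx, dotProduct_comm]
  rw [star_trivial, Matrix.fromBlocks_mulVec, Sum.elim_comp_inl, Sum.elim_comp_inr, e1, e2,
    sumElim_dotProduct_sumElim, Matrix.mulVec_smul, hPx, dotProduct_add, smul_dotProduct,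
    smul_dotProduct, dotProduct_neg, e3, dotProduct_smul, dotProduct_comm (P⁻¹ *ᵥ x) x] at h1
  simp [Matrix.smul_mulVec, dotProduct.eq_1 (fun _ : Fin 1 => (-1:ℝ))] at h1
  have h2 : 0 ≤ 2 * g * (g - F ⬝ᵥ x) := by nlinarith [mul_pos hg hg]
  have := nonneg_of_mul_nonneg_right h2 (by positivity)
  linarith

/-- The deterministic (expected-dynamics) content of Theorem 2 of the paper:
feasibility of the closed-loop LMIs with `K_i = S_i P_i⁻¹` yields (a) the closed-loop
Loewner contractivity inequalities, (b) λ-contractivity in expectation of the convex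
hull of ellipsoids for the closed-loop system, and (c) containment of the hull in
the admissible polyhedron. -/
theorem closedLoop_convexHull_contractive
    (n m nv q : ℕ) (hn : 0 < n) (hm : 0 < m) (hnv : 0 < nv) (hq : 0 < q)
    (A : Matrix (Fin n) (Fin n) ℝ) (B : Matrix (Fin n) (Fin m) ℝ)
    (lam : ℝ) (hlam : 0 < lam) (hlam1 : lam ≤ 1)
    (P : ℕ → Matrix (Fin n) (Fin n) ℝ)
    (hP : ∀ i ∈ Finset.Icc 1 nv, (P i).PosDef)
    (S : ℕ → Matrix (Fin m) (Fin n) ℝ)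
    (F : ℕ → Fin n → ℝ) (g : ℕ → ℝ)
    (hg : ∀ l ∈ Finset.Icc 1 q, 0 < g l)
    (hLMI : ∀ i ∈ Finset.Icc 1 nv,
      (Matrix.fromBlocks (P i)
        (A * P ((i + nv - 2) % nv + 1) + B * S ((i + nv - 2) % nv + 1))
        ((A * P ((i + nv - 2) % nv + 1) + B * S ((i + nv - 2) % nv + 1))ᵀ)
        (lam • P ((i + nv - 2) % nv + 1))).PosSemidef)
    (hPoly : ∀ i ∈ Finset.Icc 1 nv, ∀ l ∈ Finset.Icc 1 q,
      (Matrix.fromBlocks (P i) (Matrix.of fun r (_ : Fin 1) => ((P i) *ᵥ (F l)) r)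
        (Matrix.of fun (_ : Fin 1) c => ((F l) ᵥ* (P i)) c)
        ((g l ^ 2) • (1 : Matrix (Fin 1) (Fin 1) ℝ))).PosSemidef) :
    (∀ i ∈ Finset.Icc 1 nv,
      (lam • (P ((i + nv - 2) % nv + 1))⁻¹ -
        (A + B * (S ((i + nv - 2) % nv + 1) * (P ((i + nv - 2) % nv + 1))⁻¹))ᵀ *
          (P i)⁻¹ *
        (A + B * (S ((i + nv - 2) % nv + 1) * (P ((i + nv - 2) % nv + 1))⁻¹))).PosSemidef) ∧
    (∀ x : Fin n → ℝ, ∀ α : ℕ → ℝ, ∀ υ : ℕ → Fin n → ℝ,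
      (∀ i ∈ Finset.Icc 1 nv, 0 ≤ α i) →
      (∑ i ∈ Finset.Icc 1 nv, α i) = 1 →
      (∀ i ∈ Finset.Icc 1 nv, υ i ⬝ᵥ ((P i)⁻¹ *ᵥ υ i) ≤ 1) →
      x = ∑ i ∈ Finset.Icc 1 nv, α i • υ i →
      (A *ᵥ x + B *ᵥ (∑ i ∈ Finset.Icc 1 nv, α i • ((S i * (P i)⁻¹) *ᵥ υ i)) ∈
        convexHull ℝ (⋃ i ∈ Finset.Icc 1 nv, {z : Fin n → ℝ | z ⬝ᵥ ((P i)⁻¹ *ᵥ z) ≤ lam})) ∧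
      convexHull ℝ (⋃ i ∈ Finset.Icc 1 nv, {z : Fin n → ℝ | z ⬝ᵥ ((P i)⁻¹ *ᵥ z) ≤ lam}) ⊆
        convexHull ℝ (⋃ i ∈ Finset.Icc 1 nv, {z : Fin n → ℝ | z ⬝ᵥ ((P i)⁻¹ *ᵥ z) ≤ 1})) ∧
    (convexHull ℝ (⋃ i ∈ Finset.Icc 1 nv, {z : Fin n → ℝ | z ⬝ᵥ ((P i)⁻¹ *ᵥ z) ≤ 1}) ⊆
      {x : Fin n → ℝ | ∀ l ∈ Finset.Icc 1 q, F l ⬝ᵥ x ≤ g l}) := by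
  have hj : ∀ i ∈ Finset.Icc 1 nv, (i + nv - 2) % nv + 1 ∈ Finset.Icc 1 nv := by
    intro i _
    have := Nat.mod_lt (i + nv - 2) hnv
    rw [Finset.mem_Icc]; omega
  have ha := fun i (hi : i ∈ Finset.Icc 1 nv) =>
    cl_schur A B lam _ _ _ (hP i hi) (hP _ (hj i hi)) (hLMI i hi)
  refine ⟨ha, ?_, ?_⟩
  · intro x α υ h0 h1 hυ hx
    refine ⟨?_, ?_⟩
    · have e : A *ᵥ x + B *ᵥ (∑ i ∈ Finset.Icc 1 nv, α i • ((S i * (P i)⁻¹) *ᵥ υ i))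
          = ∑ i ∈ Finset.Icc 1 nv, α i • ((A + B * (S i * (P i)⁻¹)) *ᵥ υ i) := by
        rw [hx, Matrix.mulVec_sum, Matrix.mulVec_sum, ← Finset.sum_add_distrib]
        refine Finset.sum_congr rfl fun i _ => ?_
        rw [Matrix.mulVec_smul, Matrix.mulVec_smul, Matrix.add_mulVec, smul_add,
          Matrix.mulVec_mulVec]
      rw [e]
      refine (convex_convexHull ℝ _).sum_mem h0 h1 fun k hk => subset_convexHull ℝ _ ?_
      obtain ⟨i, hi, hik⟩ : ∃ i ∈ Finset.Icc 1 nv, (i + nv - 2) % nv + 1 = k := by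
        rw [Finset.mem_Icc] at hk
        rcases hk.2.lt_or_eq with hlt | heq
        · refine ⟨k + 1, by rw [Finset.mem_Icc]; omega, ?_⟩
          have : k + 1 + nv - 2 = (k - 1) + nv := by omega
          rw [this, Nat.add_mod_right, Nat.mod_eq_of_lt (by omega)]; omega
        · refine ⟨1, by rw [Finset.mem_Icc]; omega, ?_⟩
          rw [Nat.mod_eq_of_lt (by omega)]; omega
      have hA := ha i hi
      rw [hik] at hA
      exact Set.mem_iUnion₂.2 ⟨i, hi, cl_quad lam _ _ _ hlam hA _ (hυ k hk)⟩
    · exact convexHull_mono (Set.iUnion₂_mono fun i _ z hz => le_trans hz hlam1)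
  · refine convexHull_min ?_ ?_
    · intro x hx l hl
      obtain ⟨i, hi, hxi⟩ := Set.mem_iUnion₂.1 hx
      exact cl_poly _ (hP i hi) _ _ (hg l hl) (hPoly i hi l hl) x hxi
    · intro x hx y hy a b ha hb hab l hl
      have h1 := mul_le_mul_of_nonneg_left (hx l hl) ha
      have h2 := mul_le_mul_of_nonneg_left (hy l hl) hb
      rw [dotProduct_add, dotProduct_smul, dotProduct_smul, smul_eq_mul, smul_eq_mul]
      calc _ ≤ a * g l + b * g l := add_le_add h1 h2
        _ = g l := by rw [← add_mul, hab, one_mul]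
end

section
/- Let n, m, n_v, q, N be positive integers, A ∈ ℝ^{n×n}, B ∈ ℝ^{n×m}, 0 < λ ≤ 1, and let U_0 ∈ ℝ^{m×N}, X_0 ∈ ℝ^{n×N}, W_0 ∈ ℝ^{n×N}, X_1 ∈ ℝ^{n×N} satisfy X_1 = A X_0 + B U_0 + W_0. Let F ∈ ℝ^{q×n} with rows F_l and g ∈ ℝ^q with entries g_l > 0. Suppose there exist symmetric positive definite matrices P_1, …, P_{n_v} and matrices Y_1, …, Y_{n_v} ∈ ℝ^{N×n} such that for every i ∈ {1,…,n_v}, with j = mod(i + n_v − 2, n_v) + 1: (i) [[P_i, (X_1 − W_0) Y_j], [Y_jᵀ(X_1 − W_0)ᵀ, λ P_j]] is positive semidefinite; (ii) [[P_i, P_i F_lᵀ], [F_l P_i, g_l²]] is positive semidefinite for every l; and (iii) X_0 Y_i = P_i. Define K_i = U_0 Y_i P_i⁻¹. Then (A + B K_j)ᵀ P_i⁻¹ (A + B K_j) ⪯ λ P_j⁻¹ for every i with its corresponding j, and the set S_c = conv(⋃_{i=1}^{n_v} E(P_i,1)) is contained in {x : F x ≤ g componentwise} and satisfies: for every x ∈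 S_c written as x = ∑_i α_i υ_i with υ_i ∈ E(P_i,1) and convex weights α_i, the input u = ∑_i α_i K_i υ_i gives A x + B u ∈ conv(⋃_{i=1}^{n_v} {z : zᵀ P_i⁻¹ z ≤ λ}) ⊆ S_c. -/
open Matrix Set

lemma idx_mem {nv i : ℕ} (hi : i ∈ Finset.Icc 1 nv) : (i + nv - 2) % nv + 1 ∈ Finset.Icc 1 nv := by
  rw [Finset.mem_Icc] at hi ⊢
  have := Nat.mod_lt (i + nv - 2) (show 0 < nv by omega)
  omega

lemma idx_surj {nv j : ℕ} (hj : j ∈ Finset.Icc 1 nv) :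
    ∃ i ∈ Finset.Icc 1 nv, (i + nv - 2) % nv + 1 = j := by
  rw [Finset.mem_Icc] at hj
  rcases Nat.lt_or_ge j nv with h | h
  · refine ⟨j + 1, by rw [Finset.mem_Icc]; omega, ?_⟩
    rw [show j + 1 + nv - 2 = (j - 1) + nv by omega, Nat.add_mod_right, Nat.mod_eq_of_lt (by omega)]
    omega
  · refine ⟨1, by rw [Finset.mem_Icc]; omega, ?_⟩
    rw [show 1 + nv - 2 = nv - 1 by omega, Nat.mod_eq_of_lt (by omega)]
    omega

lemma schur_step {n : ℕ} (P Q M : Matrix (Fin n) (Fin n) ℝ) (lam : ℝ) (hP : P.PosDef)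
    (hQ : Q.PosDef) (h : (Matrix.fromBlocks P (M * Q) (M * Q)ᵀ (lam • Q)).PosSemidef) :
    (lam • Q⁻¹ - Mᵀ * P⁻¹ * M).PosSemidef := by
  haveI : Invertible P := hP.isUnit.invertible
  rw [← conjTranspose_eq_transpose_of_trivial, Matrix.PosDef.fromBlocks₁₁ _ _ hP] at h
  have h2 := h.conjTranspose_mul_mul_same Q⁻¹
  have hd : IsUnit Q.det := (Matrix.isUnit_iff_isUnit_det Q).1 hQ.isUnit
  have hs : (Q⁻¹)ᴴ = Q⁻¹ := hQ.inv.isHermitian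
  suffices key : lam • Q⁻¹ - Mᵀ * P⁻¹ * M =
      (Q⁻¹)ᴴ * (lam • Q - (M * Q)ᴴ * P⁻¹ * (M * Q)) * Q⁻¹ by
    rw [key]; exact h2
  rw [Matrix.mul_sub, Matrix.sub_mul]
  congr 1
  · rw [hs, Matrix.mul_smul, Matrix.smul_mul, Matrix.nonsing_inv_mul _ hd, Matrix.one_mul]
  · have e : M * Q * Q⁻¹ = M := by
      rw [Matrix.mul_assoc, Matrix.mul_nonsing_inv _ hd, Matrix.mul_one]
    calc Mᵀ * P⁻¹ * M = (M * Q * Q⁻¹)ᴴ * P⁻¹ * (M * Q * Q⁻¹) := by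
          rw [e, conjTranspose_eq_transpose_of_trivial]
      _ = _ := by
          rw [Matrix.conjTranspose_mul (M * Q)]
          simp only [Matrix.mul_assoc]

lemma poly_step {n : ℕ} (P : Matrix (Fin n) (Fin n) ℝ) (hP : P.PosDef) (f : Fin n → ℝ) (g : ℝ)
    (hg : 0 < g)
    (h : (Matrix.fromBlocks P (Matrix.of fun r (_ : Fin 1) => (P *ᵥ f) r)
        (Matrix.of fun (_ : Fin 1) c => (f ᵥ* P) c)
        ((g ^ 2) • (1 : Matrix (Fin 1) (Fin 1) ℝ))).PosSemidef)
    (x : Fin n → ℝ) (hx : x ⬝ᵥ (P⁻¹ *ᵥ x) ≤ 1) : f ⬝ᵥ x ≤ g := by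
  have hd : IsUnit P.det := (Matrix.isUnit_iff_isUnit_det P).1 hP.isUnit
  have hPt : Pᵀ = P := by
    rw [← conjTranspose_eq_transpose_of_trivial]; exact hP.isHermitian
  have h1 := h.dotProduct_mulVec_nonneg (Sum.elim (P⁻¹ *ᵥ x) (fun _ => - g⁻¹))
  have e0 : P *ᵥ (P⁻¹ *ᵥ x) = x := by
    rw [Matrix.mulVec_mulVec, Matrix.mul_nonsing_inv _ hd, Matrix.one_mulVec]
  have e1 : (Matrix.of fun r (_ : Fin 1) => (P *ᵥ f) r) *ᵥ (fun _ => - g⁻¹) = (- g⁻¹) • (P *ᵥ f) := by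
    ext r; simp [Matrix.mulVec, dotProduct, mul_comm]
  have e2 : (Matrix.of fun (_ : Fin 1) c => (f ᵥ* P) c) *ᵥ (P⁻¹ *ᵥ x) = fun _ => f ⬝ᵥ x := by
    ext r
    change (f ᵥ* P) ⬝ᵥ (P⁻¹ *ᵥ x) = _
    rw [← Matrix.dotProduct_mulVec, e0]
  have e3 : (P⁻¹ *ᵥ x) ⬝ᵥ (P *ᵥ f) = f ⬝ᵥ x := by
    rw [Matrix.dotProduct_mulVec, ← Matrix.mulVec_transpose, hPt, e0, dotProduct_comm]
  rw [Matrix.fromBlocks_mulVec, star_trivial] at h1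
  simp only [Sum.elim_comp_inl, Sum.elim_comp_inr, sumElim_dotProduct_sumElim, e0, e1, e2,
    dotProduct_add, dotProduct_smul, e3, Matrix.smul_mulVec, Matrix.one_mulVec] at h1
  rw [dotProduct_comm (P⁻¹ *ᵥ x) x] at h1
  simp [dotProduct] at h1
  simp only [dotProduct] at hx ⊢
  set s := ∑ i, f i * x i
  have h3 : g ^ 2 * (g⁻¹ * g⁻¹) = 1 := by field_simp
  have h4 : g⁻¹ * s ≤ 1 := by nlinarith
  rw [inv_mul_le_iff₀ hg] at h4
  linarith

/-- The deterministic content of Theorem 3 of the paper: the data-based LMIs with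
measured noise, together with `X₀ Y_i = P_i` and `K_i = U₀ Y_i P_i⁻¹`, yield the
closed-loop Loewner contractivity inequalities, containment of the convex hull of
ellipsoids in the admissible polyhedron, and λ-contractivity in expectation of the
convex hull for the closed-loop system. -/
theorem data_based_convexHull_contractive
    (n m nv q N : ℕ) (hn : 0 < n) (hm : 0 < m) (hnv : 0 < nv) (hq : 0 < q) (hN : 0 < N)
    (A : Matrix (Fin n) (Fin n) ℝ) (B : Matrix (Fin n) (Fin m) ℝ)
    (lam : ℝ) (hlam : 0 < lam) (hlam1 : lam ≤ 1)
    (U0 : Matrix (Fin m) (Fin N) ℝ) (X0 W0 X1 : Matrix (Fin n) (Fin N) ℝ)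
    (hdata : X1 = A * X0 + B * U0 + W0)
    (F : ℕ → Fin n → ℝ) (g : ℕ → ℝ)
    (hg : ∀ l ∈ Finset.Icc 1 q, 0 < g l)
    (P : ℕ → Matrix (Fin n) (Fin n) ℝ)
    (hP : ∀ i ∈ Finset.Icc 1 nv, (P i).PosDef)
    (Y : ℕ → Matrix (Fin N) (Fin n) ℝ)
    (hLMI : ∀ i ∈ Finset.Icc 1 nv,
      (Matrix.fromBlocks (P i)
        ((X1 - W0) * Y ((i + nv - 2) % nv + 1))
        (((X1 - W0) * Y ((i + nv - 2) % nv + 1))ᵀ)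
        (lam • P ((i + nv - 2) % nv + 1))).PosSemidef)
    (hPoly : ∀ i ∈ Finset.Icc 1 nv, ∀ l ∈ Finset.Icc 1 q,
      (Matrix.fromBlocks (P i) (Matrix.of fun r (_ : Fin 1) => ((P i) *ᵥ (F l)) r)
        (Matrix.of fun (_ : Fin 1) c => ((F l) ᵥ* (P i)) c)
        ((g l ^ 2) • (1 : Matrix (Fin 1) (Fin 1) ℝ))).PosSemidef)
    (hXY : ∀ i ∈ Finset.Icc 1 nv, X0 * Y i = P i) :
    (∀ i ∈ Finset.Icc 1 nv,
      (lam • (P ((i + nv - 2) % nv + 1))⁻¹ -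
        (A + B * (U0 * Y ((i + nv - 2) % nv + 1) * (P ((i + nv - 2) % nv + 1))⁻¹))ᵀ *
          (P i)⁻¹ *
        (A + B * (U0 * Y ((i + nv - 2) % nv + 1) *
          (P ((i + nv - 2) % nv + 1))⁻¹))).PosSemidef) ∧
    (convexHull ℝ (⋃ i ∈ Finset.Icc 1 nv, {z : Fin n → ℝ | z ⬝ᵥ ((P i)⁻¹ *ᵥ z) ≤ 1}) ⊆
      {x : Fin n → ℝ | ∀ l ∈ Finset.Icc 1 q, F l ⬝ᵥ x ≤ g l}) ∧
    (∀ x : Fin n → ℝ, ∀ α : ℕ → ℝ, ∀ υ : ℕ → Fin n → ℝ,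
      (∀ i ∈ Finset.Icc 1 nv, 0 ≤ α i) →
      (∑ i ∈ Finset.Icc 1 nv, α i) = 1 →
      (∀ i ∈ Finset.Icc 1 nv, υ i ⬝ᵥ ((P i)⁻¹ *ᵥ υ i) ≤ 1) →
      x = ∑ i ∈ Finset.Icc 1 nv, α i • υ i →
      (A *ᵥ x + B *ᵥ (∑ i ∈ Finset.Icc 1 nv, α i • ((U0 * Y i * (P i)⁻¹) *ᵥ υ i)) ∈
        convexHull ℝ (⋃ i ∈ Finset.Icc 1 nv, {z : Fin n → ℝ | z ⬝ᵥ ((P i)⁻¹ *ᵥ z) ≤ lam})) ∧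
      convexHull ℝ (⋃ i ∈ Finset.Icc 1 nv, {z : Fin n → ℝ | z ⬝ᵥ ((P i)⁻¹ *ᵥ z) ≤ lam}) ⊆
        convexHull ℝ (⋃ i ∈ Finset.Icc 1 nv, {z : Fin n → ℝ | z ⬝ᵥ ((P i)⁻¹ *ᵥ z) ≤ 1})) := by
  have hM : ∀ i ∈ Finset.Icc 1 nv,
      (X1 - W0) * Y i = (A + B * (U0 * Y i * (P i)⁻¹)) * P i := by
    intro i hi
    have hd : IsUnit (P i).det := (Matrix.isUnit_iff_isUnit_det _).1 (hP i hi).isUnit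
    rw [hdata, add_sub_cancel_right, Matrix.add_mul, Matrix.add_mul, Matrix.mul_assoc, hXY i hi,
      Matrix.mul_assoc B (_ * _), Matrix.mul_assoc (U0 * Y i), Matrix.nonsing_inv_mul _ hd,
      Matrix.mul_one, Matrix.mul_assoc]
  have h1 : ∀ i ∈ Finset.Icc 1 nv,
      (lam • (P ((i + nv - 2) % nv + 1))⁻¹ -
        (A + B * (U0 * Y ((i + nv - 2) % nv + 1) * (P ((i + nv - 2) % nv + 1))⁻¹))ᵀ *
          (P i)⁻¹ *
        (A + B * (U0 * Y ((i + nv - 2) % nv + 1) *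
          (P ((i + nv - 2) % nv + 1))⁻¹))).PosSemidef := by
    intro i hi
    have h := hLMI i hi
    rw [hM _ (idx_mem hi)] at h
    exact schur_step _ _ _ _ (hP i hi) (hP _ (idx_mem hi)) h
  refine ⟨h1, ?_, ?_⟩
  · apply convexHull_min
    · intro z hz
      simp only [Set.mem_iUnion] at hz
      obtain ⟨i, hi, hz⟩ := hz
      intro l hl
      exact poly_step _ (hP i hi) _ _ (hg l hl) (hPoly i hi l hl) z hz
    · intro x hx y hy a b ha hb hab l hl
      rw [dotProduct_add, dotProduct_smul, dotProduct_smul, smul_eq_mul, smul_eq_mul]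
      have := mul_le_mul_of_nonneg_left (hx l hl) ha
      have := mul_le_mul_of_nonneg_left (hy l hl) hb
      calc _ ≤ a * g l + b * g l := by linarith
        _ = g l := by rw [← add_mul, hab, one_mul]
  · intro x α υ hα hs hυ hx
    refine ⟨?_, ?_⟩
    · have : A *ᵥ x + B *ᵥ (∑ i ∈ Finset.Icc 1 nv, α i • ((U0 * Y i * (P i)⁻¹) *ᵥ υ i)) =
          ∑ i ∈ Finset.Icc 1 nv, α i • ((A + B * (U0 * Y i * (P i)⁻¹)) *ᵥ υ i) := by
        rw [hx, Matrix.mulVec_sum, Matrix.mulVec_sum, ← Finset.sum_add_distrib]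
        refine Finset.sum_congr rfl fun i _ => ?_
        rw [Matrix.mulVec_smul, Matrix.mulVec_smul, Matrix.add_mulVec, smul_add,
          Matrix.mulVec_mulVec]
      rw [this]
      refine (convex_convexHull ℝ _).sum_mem hα hs fun j hj => subset_convexHull ℝ _ ?_
      obtain ⟨i, hi, rfl⟩ := idx_surj hj
      simp only [Set.mem_iUnion]
      refine ⟨i, hi, ?_⟩
      have h := (h1 i hi).dotProduct_mulVec_nonneg (υ ((i + nv - 2) % nv + 1))
      have hv := hυ _ hj
      rw [star_trivial, Matrix.sub_mulVec, dotProduct_sub, Matrix.smul_mulVec, dotProduct_smul,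
        ← Matrix.mulVec_mulVec, ← Matrix.mulVec_mulVec, Matrix.dotProduct_mulVec _ (_ᵀ),
        Matrix.vecMul_transpose, smul_eq_mul] at h
      rw [Set.mem_setOf_eq]
      have := mul_le_mul_of_nonneg_left hv hlam.le
      linarith
    · apply convexHull_mono
      exact Set.iUnion₂_mono fun i _ z hz => le_trans hz hlam1
end

section
/- Let P and V be symmetric positive definite n×n real matrices, let τ > 0 be such that τ V⁻¹ − P⁻¹ is positive definite, let c ∈ ℝ^n, and let λ > 0. If λ − τ − cᵀ (P − τ⁻¹ V)⁻¹ c ≥ 0, then the ellipsoid {v ∈ ℝ^n : (v − c)ᵀ V⁻¹ (v − c) ≤ 1} is contained in the ellipsoid {v ∈ ℝ^n : vᵀ P⁻¹ v ≤ λ}. -/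
open Matrix

/-- The S-procedure sufficiency step of Theorem 4 of the paper: if
`λ − τ − cᵀ (P − τ⁻¹ V)⁻¹ c ≥ 0`, then the confidence ellipsoid
`{v : (v − c)ᵀ V⁻¹ (v − c) ≤ 1}` lies inside the scaled ellipsoid
`{v : vᵀ P⁻¹ v ≤ λ}`. -/
theorem sProcedure_ellipsoid_inclusion
    (n : ℕ) (P V : Matrix (Fin n) (Fin n) ℝ) (hP : P.PosDef) (hV : V.PosDef)
    (τ : ℝ) (hτ : 0 < τ) (hPD : (τ • V⁻¹ - P⁻¹).PosDef)
    (c : Fin n → ℝ) (lam : ℝ) (hlam : 0 < lam)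
    (hcert : 0 ≤ lam - τ - c ⬝ᵥ ((P - τ⁻¹ • V)⁻¹ *ᵥ c)) :
    {v : Fin n → ℝ | (v - c) ⬝ᵥ (V⁻¹ *ᵥ (v - c)) ≤ 1} ⊆
      {v : Fin n → ℝ | v ⬝ᵥ (P⁻¹ *ᵥ v) ≤ lam} := by
  have hPu : IsUnit P.det := (Matrix.isUnit_iff_isUnit_det _).1 hP.isUnit
  have hVu : IsUnit V.det := (Matrix.isUnit_iff_isUnit_det _).1 hV.isUnit
  have hDu : IsUnit (τ • V⁻¹ - P⁻¹).det := (Matrix.isUnit_iff_isUnit_det _).1 hPD.isUnit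
  have hAs : (P⁻¹)ᵀ = P⁻¹ := by
    have h := hP.isHermitian.inv
    simpa [Matrix.IsHermitian, Matrix.conjTranspose_eq_transpose_of_trivial] using h
  have hDs : (τ • V⁻¹ - P⁻¹)ᵀ = τ • V⁻¹ - P⁻¹ := by
    have h := hPD.isHermitian
    rwa [Matrix.IsHermitian, Matrix.conjTranspose_eq_transpose_of_trivial] at h
  have hW : V⁻¹ = τ⁻¹ • ((τ • V⁻¹ - P⁻¹) + P⁻¹) := by
    rw [sub_add_cancel, smul_smul, inv_mul_cancel₀ hτ.ne', one_smul]
  have hPA : P * P⁻¹ = 1 := Matrix.mul_nonsing_inv _ hPu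
  have hVV : V * V⁻¹ = 1 := Matrix.mul_nonsing_inv _ hVu
  have hQA : (P - τ⁻¹ • V) * P⁻¹ = τ⁻¹ • (V * (τ • V⁻¹ - P⁻¹)) := by
    rw [Matrix.sub_mul, Matrix.mul_sub, hPA, Matrix.mul_smul, hVV, smul_sub, smul_smul,
      inv_mul_cancel₀ hτ.ne', one_smul, Matrix.smul_mul]
  have hVD : τ⁻¹ • (V * ((τ • V⁻¹ - P⁻¹) + P⁻¹)) = 1 := by
    rw [← Matrix.mul_smul, ← hW, hVV]
  generalize hD : τ • V⁻¹ - P⁻¹ = D at *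
  generalize hA : P⁻¹ = A at *
  have hDD : D * D⁻¹ = 1 := Matrix.mul_nonsing_inv _ hDu
  have hQ : (P - τ⁻¹ • V)⁻¹ = A + A * (D⁻¹ * A) := by
    apply Matrix.inv_eq_right_inv
    rw [Matrix.mul_add, ← Matrix.mul_assoc, hQA, Matrix.smul_mul, Matrix.mul_assoc V D,
      ← Matrix.mul_assoc D, hDD, Matrix.one_mul, ← smul_add, ← Matrix.mul_add, hVD]
  have symm : ∀ (M : Matrix (Fin n) (Fin n) ℝ), Mᵀ = M → ∀ x y : Fin n → ℝ,
      x ⬝ᵥ (M *ᵥ y) = y ⬝ᵥ (M *ᵥ x) := by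
    intro M hM x y
    rw [Matrix.dotProduct_mulVec, ← Matrix.mulVec_transpose, hM, dotProduct_comm]
  intro v hv
  simp only [Set.mem_setOf_eq] at hv ⊢
  obtain ⟨u, rfl⟩ : ∃ u, v = u + c := ⟨v - c, by simp⟩
  rw [add_sub_cancel_right, hW] at hv
  rw [hQ] at hcert
  set w := D⁻¹ *ᵥ (A *ᵥ c) with hw
  have hDw : D *ᵥ w = A *ᵥ c := by rw [hw, Matrix.mulVec_mulVec, hDD, Matrix.one_mulVec]
  have hpos : 0 ≤ (u - w) ⬝ᵥ (D *ᵥ (u - w)) := by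
    simpa using hPD.posSemidef.dotProduct_mulVec_nonneg (u - w)
  have e1 := symm D hDs w u
  have e2 := symm A hAs c u
  have e3 := symm A hAs c w
  simp only [Matrix.add_mulVec, ← Matrix.mulVec_mulVec, ← hw, Matrix.smul_mulVec,
    dotProduct_smul, smul_eq_mul, dotProduct_add, add_dotProduct, sub_dotProduct,
    dotProduct_sub, Matrix.mulVec_add, Matrix.mulVec_sub, hDw] at *
  rw [inv_mul_le_iff₀ hτ] at hv
  linarith
end

section
/- Let w be a random vector in ℝ^n with mean μ and covariance matrix Σ (each coordinate having finite variance), let H, M ∈ ℝ^{q×n} with rows H_j, M_j, let g ∈ ℝ^q with entries g_j, let x ∈ ℝ^n, and let ε ∈ (0,1). Suppose there exist ε_1, …, ε_q ∈ (0,1) with ∑_{j=1}^q ε_j ≤ ε such that for every j ∈ {1,…,q}, H_j x + M_j μ ≤ g_j − k_j √(M_j Σ M_jᵀ), where k_j = √((1 − ε_j)/ε_j). Then P[H x + M w ≤ g componentwise] ≥ 1 − ε. -/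
open Matrix MeasureTheory

theorem cantelli_aux {Ω : Type*} [MeasurableSpace Ω] (P : Measure Ω) [IsProbabilityMeasure P]
    (Y : Ω → ℝ) (hY : Integrable Y P) (hY0 : ∫ ω, Y ω ∂P = 0)
    (hY2 : Integrable (fun ω => Y ω ^ 2) P) (V e : ℝ) (hV : ∫ ω, Y ω ^ 2 ∂P = V)
    (he : 0 < e) (he1 : e < 1) :
    P.real {ω | Real.sqrt ((1 - e) / e) * Real.sqrt V < Y ω} ≤ e := by
  have hV0 : 0 ≤ V := by rw [← hV]; exact integral_nonneg fun ω => sq_nonneg _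
  rcases hV0.eq_or_lt with h0 | hpos
  · subst h0
    have h1 := (integral_eq_zero_iff_of_nonneg (fun ω => sq_nonneg (Y ω)) hY2).1 hV
    have h2 : P {ω | Real.sqrt ((1 - e) / e) * Real.sqrt 0 < Y ω} = 0 := by
      refine measure_mono_null ?_ (ae_iff.1 h1)
      intro ω hω
      simp only [Real.sqrt_zero, mul_zero, Set.mem_ofPred_eq] at hω
      simp only [Set.mem_ofPred_eq, Pi.zero_apply]
      positivity
    rw [measureReal_def, h2]
    simpa using he.le
  · have hk : 0 < Real.sqrt ((1 - e) / e) := Real.sqrt_pos.2 (div_pos (by linarith) he)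
    have hk2 : Real.sqrt ((1 - e) / e) ^ 2 = (1 - e) / e :=
      Real.sq_sqrt (div_pos (by linarith) he).le
    have hs : 0 < Real.sqrt V := Real.sqrt_pos.2 hpos
    have hs2 : Real.sqrt V ^ 2 = V := Real.sq_sqrt hpos.le
    generalize Real.sqrt ((1 - e) / e) = k at *
    generalize Real.sqrt V = s at *
    have hint : Integrable (fun ω => (Y ω + s / k) ^ 2) P := by
      have : (fun ω => (Y ω + s / k) ^ 2)
          = fun ω => Y ω ^ 2 + (2 * (s / k)) * Y ω + (s / k) ^ 2 := by
        funext ω; ring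
      rw [this]
      exact (hY2.add (hY.const_mul _)).add (integrable_const _)
    have hval : ∫ ω, (Y ω + s / k) ^ 2 ∂P = s ^ 2 + (s / k) ^ 2 := by
      have : (fun ω => (Y ω + s / k) ^ 2)
          = fun ω => Y ω ^ 2 + (2 * (s / k)) * Y ω + (s / k) ^ 2 := by
        funext ω; ring
      have hA : Integrable (fun ω => Y ω ^ 2 + (2 * (s / k)) * Y ω) P := hY2.add (hY.const_mul _)
      rw [this, integral_add hA (integrable_const _),
        integral_add hY2 (hY.const_mul _), integral_const_mul, hY0, hV, hs2]
      simp
    have hm := mul_meas_ge_le_integral_of_nonneg (μ := P)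
      (Filter.Eventually.of_forall fun ω => sq_nonneg (Y ω + s / k)) hint ((k * s + s / k) ^ 2)
    have hsub : P.real {ω | k * s < Y ω} ≤
        P.real {ω | (k * s + s / k) ^ 2 ≤ (Y ω + s / k) ^ 2} := by
      refine measureReal_mono ?_
      intro ω hω
      simp only [Set.mem_ofPred_eq] at hω ⊢
      have : 0 < k * s := by positivity
      have : 0 < s / k := by positivity
      gcongr
    rw [hval] at hm
    have hkey : s ^ 2 + (s / k) ^ 2 = (k * s + s / k) ^ 2 * e := by
      have h1 : (k ^ 2 + 1) * e = 1 := by rw [hk2]; field_simp; ring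
      have h2 : (k * s + s / k) ^ 2 * e
          = (s ^ 2 + (s / k) ^ 2) * ((k ^ 2 + 1) * e) := by
        field_simp
      rw [h2, h1, mul_one]
    rw [hkey] at hm
    exact hsub.trans (le_of_mul_le_mul_left hm (by positivity))

/-- Lemma 2 of the paper: decomposition of a joint chance constraint into individual
deterministic constraints. If for each row `j`,
`H_j x + M_j μ ≤ g_j − k_j √(M_j Σ M_jᵀ)` with `k_j = √((1 − ε_j)/ε_j)` and
`∑ ε_j ≤ ε`, then `P[H x + M w ≤ g] ≥ 1 − ε`. -/
theorem joint_chance_constraint_decomposition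
    {Ω : Type*} [MeasurableSpace Ω] (P : Measure Ω) [IsProbabilityMeasure P]
    (n q : ℕ) (w : Ω → Fin n → ℝ) (hwmeas : Measurable w)
    (μv : Fin n → ℝ) (Sig : Matrix (Fin n) (Fin n) ℝ)
    (hmean : ∀ i, Integrable (fun ω => w ω i) P ∧ ∫ ω, w ω i ∂P = μv i)
    (hcov : ∀ i j, Integrable (fun ω => (w ω i - μv i) * (w ω j - μv j)) P ∧
      ∫ ω, (w ω i - μv i) * (w ω j - μv j) ∂P = Sig i j)
    (H M : ℕ → Fin n → ℝ) (g : ℕ → ℝ) (x : Fin n → ℝ)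
    (ε : ℝ) (hε : 0 < ε) (hε1 : ε < 1)
    (ε' : ℕ → ℝ) (hε' : ∀ j ∈ Finset.Icc 1 q, 0 < ε' j ∧ ε' j < 1)
    (hsum : (∑ j ∈ Finset.Icc 1 q, ε' j) ≤ ε)
    (hrow : ∀ j ∈ Finset.Icc 1 q,
      H j ⬝ᵥ x + M j ⬝ᵥ μv ≤
        g j - Real.sqrt ((1 - ε' j) / ε' j) * Real.sqrt (M j ⬝ᵥ (Sig *ᵥ M j))) :
    (P {ω | ∀ j ∈ Finset.Icc 1 q, H j ⬝ᵥ x + M j ⬝ᵥ w ω ≤ g j}).toReal ≥ 1 - ε := by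
  have hrowP : ∀ j ∈ Finset.Icc 1 q,
      P.real {ω | g j < H j ⬝ᵥ x + M j ⬝ᵥ w ω} ≤ ε' j := by
    intro j hj
    have hYi : ∀ i, Integrable (fun ω => M j i * (w ω i - μv i)) P := fun i =>
      ((hmean i).1.sub (integrable_const _)).const_mul _
    have hsq : ∀ ω, (∑ i, M j i * (w ω i - μv i)) ^ 2
        = ∑ i, ∑ l, M j i * M j l * ((w ω i - μv i) * (w ω l - μv l)) := by
      intro ω
      rw [sq, Finset.sum_mul_sum]
      refine Finset.sum_congr rfl fun i _ => Finset.sum_congr rfl fun l _ => ?_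
      ring
    have hc := cantelli_aux P (fun ω => ∑ i, M j i * (w ω i - μv i))
      (integrable_finsetSum _ fun i _ => hYi i)
      (by
        rw [integral_finsetSum _ fun i _ => hYi i]
        refine Finset.sum_eq_zero fun i _ => ?_
        rw [integral_const_mul, integral_sub (hmean i).1 (integrable_const _), (hmean i).2]
        simp)
      (by
        simp only [hsq]
        exact integrable_finsetSum _ fun i _ => integrable_finsetSum _ fun l _ =>
          (hcov i l).1.const_mul _)
      (M j ⬝ᵥ (Sig *ᵥ M j)) (ε' j)
      (by
        simp only [hsq]
        rw [integral_finsetSum _ fun i _ => integrable_finsetSum _ fun l _ =>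
          (hcov i l).1.const_mul _]
        simp only [dotProduct, mulVec, Finset.mul_sum]
        refine Finset.sum_congr rfl fun i _ => ?_
        rw [integral_finsetSum _ fun l _ => (hcov i l).1.const_mul _]
        refine Finset.sum_congr rfl fun l _ => ?_
        rw [integral_const_mul, (hcov i l).2]
        ring)
      (hε' j hj).1 (hε' j hj).2
    refine (measureReal_mono ?_).trans hc
    intro ω hω
    simp only [Set.mem_ofPred_eq] at hω ⊢
    have h1 : ∑ i, M j i * (w ω i - μv i) = M j ⬝ᵥ w ω - M j ⬝ᵥ μv := by
      simp only [dotProduct, mul_sub, Finset.sum_sub_distrib]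
    rw [h1]
    have := hrow j hj
    linarith
  have hmeas : MeasurableSet {ω | ∀ j ∈ Finset.Icc 1 q, H j ⬝ᵥ x + M j ⬝ᵥ w ω ≤ g j} := by
    have : {ω | ∀ j ∈ Finset.Icc 1 q, H j ⬝ᵥ x + M j ⬝ᵥ w ω ≤ g j}
        = ⋂ j ∈ Finset.Icc 1 q, {ω | H j ⬝ᵥ x + M j ⬝ᵥ w ω ≤ g j} := by
      ext ω; simp
    rw [this]
    refine Finset.measurableSet_biInter _ fun j _ => ?_
    refine measurableSet_le ?_ measurable_const
    simp only [dotProduct]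
    fun_prop
  have hcompl := probReal_compl_eq_one_sub (μ := P) hmeas
  have hU : P.real {ω | ∀ j ∈ Finset.Icc 1 q, H j ⬝ᵥ x + M j ⬝ᵥ w ω ≤ g j}ᶜ ≤ ε := by
    have : {ω | ∀ j ∈ Finset.Icc 1 q, H j ⬝ᵥ x + M j ⬝ᵥ w ω ≤ g j}ᶜ
        = ⋃ j ∈ Finset.Icc 1 q, {ω | g j < H j ⬝ᵥ x + M j ⬝ᵥ w ω} := by
      ext ω; simp [and_assoc]
    rw [this]
    exact (measureReal_biUnion_finset_le _ _).trans ((Finset.sum_le_sum hrowP).trans hsum)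
  rw [hcompl, measureReal_def] at hU
  linarith
end
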